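/- Let q ≥ 1, d ≥ 1, let 𝒳 ⊆ ℝ^d be compact, let f : ℝ^d → ℝ be q-times continuously differentiable, and let D ⊆ 𝒳 be nonempty and closed. Then there exists a constant C > 0 such that for all ε > 0, sup over x, y ∈ 𝒳 with ‖x − y‖₂ < ε of |B^up_{q,f,D}(x) − B^up_{q,f,D}(y)| is at most C·ε; in particular B^up_{q,f,D} is Lipschitz continuous on 𝒳. -/

import Mathlib

noncomputable section

open Filter MeasureTheory
open scoped Topology

/-- Euclidean space `ℝ^d`. -/
abbrev Euc (d : ℕ) := EuclideanSpace ℝ (Fin d)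

/-- `ℓ`-th directional derivative of `f` in direction `v` at `x`. -/
def dirDeriv {d : ℕ} (ℓ : ℕ) (f : Euc d → ℝ) (v x : Euc d) : ℝ :=
  iteratedFDeriv ℝ ℓ f x (fun _ => v)

open Classical in
/-- The unit vector pointing from `x₀` to `x₁` (and `0` if `x₀ = x₁`). -/
def unitDir {d : ℕ} (x₀ x₁ : Euc d) : Euc d :=
  if x₀ = x₁ then 0 else ‖x₁ - x₀‖⁻¹ • (x₁ - x₀)

/-- The partial Taylor sum up to order `q - 1` anchored at `x₀`, evaluated at `x`. -/
def taylorPart {d : ℕ} (q : ℕ) (f : Euc d → ℝ) (x₀ x : Euc d) : ℝ :=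
  ∑ ℓ ∈ Finset.range q,
    dirDeriv ℓ f (unitDir x₀ x) x₀ * ‖x - x₀‖ ^ ℓ / (Nat.factorial ℓ : ℝ)

/-- Lower extrapolation bound `B^lo_{q,f,D}`. -/
def Blo {d : ℕ} (q : ℕ) (f : Euc d → ℝ) (D : Set (Euc d)) (x : Euc d) : ℝ :=
  sSup ((fun x₀ => taylorPart q f x₀ x +
    sInf ((fun z => dirDeriv q f (unitDir x₀ x) z) '' D) * ‖x - x₀‖ ^ q / (Nat.factorial q : ℝ)) '' D)

/-- Upper extrapolation bound `B^up_{q,f,D}`. -/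
def Bup {d : ℕ} (q : ℕ) (f : Euc d → ℝ) (D : Set (Euc d)) (x : Euc d) : ℝ :=
  sInf ((fun x₀ => taylorPart q f x₀ x +
    sSup ((fun z => dirDeriv q f (unitDir x₀ x) z) '' D) * ‖x - x₀‖ ^ q / (Nat.factorial q : ℝ)) '' D)

/-- `g` is `q`-th derivative dominated by `f` over `D` (relative to the domain `𝒳`),
written `g ⊲_D^q f`. -/
def DerivDominated {d : ℕ} (q : ℕ) (𝒳 D : Set (Euc d)) (g f : Euc d → ℝ) : Prop :=
  ∀ v : Euc d, ‖v‖ = 1 →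
    sInf ((fun z => dirDeriv q f v z) '' D) ≤ sInf ((fun x => dirDeriv q g v x) '' 𝒳) ∧
    sSup ((fun x => dirDeriv q g v x) '' 𝒳) ≤ sSup ((fun z => dirDeriv q f v z) '' D)

theorem sInf_image_le_sInf_image_add {α : Type*} {s : Set α} (hs : s.Nonempty) {F G : α → ℝ}
    {δ : ℝ} (hF : BddBelow (F '' s)) (h : ∀ a ∈ s, F a ≤ G a + δ) :
    sInf (F '' s) ≤ sInf (G '' s) + δ := by
  rw [← sub_le_iff_le_add]
  refine le_csInf (hs.image G) ?_
  rintro _ ⟨a, ha, rfl⟩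
  linarith [csInf_le hF (Set.mem_image_of_mem F ha), h a ha]

theorem sSup_image_le_sSup_image_add {α : Type*} {s : Set α} (hs : s.Nonempty) {F G : α → ℝ}
    {δ : ℝ} (hG : BddAbove (G '' s)) (h : ∀ a ∈ s, F a ≤ G a + δ) :
    sSup (F '' s) ≤ sSup (G '' s) + δ := by
  refine csSup_le (hs.image F) ?_
  rintro _ ⟨a, ha, rfl⟩
  linarith [le_csSup hG (Set.mem_image_of_mem G ha), h a ha]

/-- Directional derivatives are homogeneous of degree `ℓ` in the direction. -/
theorem dirDeriv_smul {d : ℕ} (ℓ : ℕ) (f : Euc d → ℝ) (c : ℝ) (v x : Euc d) :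
    dirDeriv ℓ f (c • v) x = c ^ ℓ * dirDeriv ℓ f v x := by
  have h := (iteratedFDeriv ℝ ℓ f x).map_smul_univ (fun _ => c) (fun _ => v)
  simpa [dirDeriv] using h

theorem norm_smul_unitDir {d : ℕ} (x₀ x : Euc d) : ‖x - x₀‖ • unitDir x₀ x = x - x₀ := by
  unfold unitDir
  split_ifs with h
  · simp [h]
  · rw [smul_smul, mul_inv_cancel₀ (norm_ne_zero_iff.2 (sub_ne_zero.2 (Ne.symm h))), one_smul]

theorem dirDeriv_unitDir_mul {d : ℕ} (ℓ : ℕ) (f : Euc d → ℝ) (x₀ x z : Euc d) :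
    dirDeriv ℓ f (unitDir x₀ x) z * ‖x - x₀‖ ^ ℓ = dirDeriv ℓ f (x - x₀) z := by
  rw [mul_comm, ← dirDeriv_smul, norm_smul_unitDir]

theorem abs_dirDeriv_le {d ℓ : ℕ} {f : Euc d → ℝ} {z w : Euc d} {K R : ℝ}
    (hK : ‖iteratedFDeriv ℝ ℓ f z‖ ≤ K) (hw : ‖w‖ ≤ R) :
    |dirDeriv ℓ f w z| ≤ K * R ^ ℓ := by
  have h := (iteratedFDeriv ℝ ℓ f z).le_opNorm (fun _ => w)
  rw [Finset.prod_const, Finset.card_univ, Fintype.card_fin, Real.norm_eq_abs] at h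
  have hK₀ : 0 ≤ K := (norm_nonneg _).trans hK
  refine h.trans ?_
  gcongr

/-- On a ball, directional derivatives are Lipschitz in the direction. -/
theorem abs_dirDeriv_sub_le {d ℓ : ℕ} {f : Euc d → ℝ} {z v w : Euc d} {K R : ℝ}
    (hK : ‖iteratedFDeriv ℝ ℓ f z‖ ≤ K) (hv : ‖v‖ ≤ R) (hw : ‖w‖ ≤ R) :
    |dirDeriv ℓ f v z - dirDeriv ℓ f w z| ≤ K * ℓ * R ^ (ℓ - 1) * ‖v - w‖ := by
  have h := (iteratedFDeriv ℝ ℓ f z).norm_image_sub_le (fun _ => v) (fun _ => w)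
  rw [Fintype.card_fin, Real.norm_eq_abs] at h
  have hR : 0 ≤ R := (norm_nonneg _).trans hv
  have hK₀ : 0 ≤ K := (norm_nonneg _).trans hK
  have hvw : ‖(fun _ : Fin ℓ => v) - fun _ => w‖ ≤ ‖v - w‖ := by
    rw [pi_norm_le_iff_of_nonneg (norm_nonneg _)]
    exact fun _ => le_rfl
  have hmax : max ‖fun _ : Fin ℓ => v‖ ‖fun _ : Fin ℓ => w‖ ≤ R :=
    max_le ((pi_norm_le_iff_of_nonneg hR).2 fun _ => hv)
      ((pi_norm_le_iff_of_nonneg hR).2 fun _ => hw)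
  refine h.trans ?_
  gcongr

/-- The Taylor polynomial at `x₀`, as a function of the displacement `w`, with the top-order
directional derivative replaced by its supremum over `D`. -/
def upperTaylor {d : ℕ} (q : ℕ) (f : Euc d → ℝ) (D : Set (Euc d)) (w x₀ : Euc d) : ℝ :=
  ∑ ℓ ∈ Finset.range q, dirDeriv ℓ f w x₀ / (Nat.factorial ℓ : ℝ) +
    sSup ((fun z => dirDeriv q f w z) '' D) / (Nat.factorial q : ℝ)

theorem Bup_eq_sInf_upperTaylor {d : ℕ} (q : ℕ) (f : Euc d → ℝ) (D : Set (Euc d)) (x : Euc d) :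
    Bup q f D x = sInf ((fun x₀ => upperTaylor q f D (x - x₀) x₀) '' D) := by
  have hsup (x₀ : Euc d) : sSup ((fun z => dirDeriv q f (unitDir x₀ x) z) '' D) * ‖x - x₀‖ ^ q =
      sSup ((fun z => dirDeriv q f (x - x₀) z) '' D) := by
    rw [sSup_image', sSup_image', Real.iSup_mul_of_nonneg (by positivity)]
    simp_rw [dirDeriv_unitDir_mul]
  simp only [Bup, upperTaylor, taylorPart, hsup, dirDeriv_unitDir_mul]

section Bounds

variable {d q : ℕ} {f : Euc d → ℝ} {D : Set (Euc d)} {K : ℕ → ℝ} {R : ℝ}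

theorem bddAbove_dirDeriv_image (hK : ∀ z ∈ D, ‖iteratedFDeriv ℝ q f z‖ ≤ K q) (w : Euc d) :
    BddAbove ((fun z => dirDeriv q f w z) '' D) := by
  refine ⟨K q * ‖w‖ ^ q, ?_⟩
  rintro _ ⟨z, hz, rfl⟩
  exact (le_abs_self _).trans (abs_dirDeriv_le (hK z hz) le_rfl)

theorem neg_sum_le_upperTaylor (hK : ∀ ℓ ≤ q, ∀ z ∈ D, ‖iteratedFDeriv ℝ ℓ f z‖ ≤ K ℓ)
    {w x₀ : Euc d} (hx₀ : x₀ ∈ D) (hw : ‖w‖ ≤ R) :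
    -∑ ℓ ∈ Finset.range (q + 1), K ℓ * R ^ ℓ / (Nat.factorial ℓ : ℝ) ≤
      upperTaylor q f D w x₀ := by
  have hsup : dirDeriv q f w x₀ ≤ sSup ((fun z => dirDeriv q f w z) '' D) :=
    le_csSup (bddAbove_dirDeriv_image (hK q le_rfl) w) (Set.mem_image_of_mem _ hx₀)
  calc
    _ ≤ ∑ ℓ ∈ Finset.range (q + 1), dirDeriv ℓ f w x₀ / (Nat.factorial ℓ : ℝ) := by
      rw [← Finset.sum_neg_distrib]
      refine Finset.sum_le_sum fun ℓ hℓ => ?_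
      rw [← neg_div]
      gcongr
      exact (abs_le.1 (abs_dirDeriv_le (hK ℓ (by grind) x₀ hx₀) hw)).1
    _ ≤ upperTaylor q f D w x₀ := by
      rw [Finset.sum_range_succ, upperTaylor]
      gcongr

theorem upperTaylor_le_add (hK : ∀ ℓ ≤ q, ∀ z ∈ D, ‖iteratedFDeriv ℝ ℓ f z‖ ≤ K ℓ)
    {v w x₀ : Euc d} (hx₀ : x₀ ∈ D) (hv : ‖v‖ ≤ R) (hw : ‖w‖ ≤ R) :
    upperTaylor q f D v x₀ ≤ upperTaylor q f D w x₀ +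
      (∑ ℓ ∈ Finset.range (q + 1), K ℓ * ℓ * R ^ (ℓ - 1) / (Nat.factorial ℓ : ℝ)) * ‖v - w‖ := by
  have hterm {ℓ : ℕ} (hℓ : ℓ ≤ q) (z : Euc d) (hz : z ∈ D) :
      dirDeriv ℓ f v z ≤ dirDeriv ℓ f w z + K ℓ * ℓ * R ^ (ℓ - 1) * ‖v - w‖ := by
    linarith [(abs_le.1 (abs_dirDeriv_sub_le (hK ℓ hℓ z hz) hv hw)).2]
  have hsup := sSup_image_le_sSup_image_add ⟨x₀, hx₀⟩
    (bddAbove_dirDeriv_image (hK q le_rfl) w) (hterm le_rfl)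
  have hsum : ∑ ℓ ∈ Finset.range q, dirDeriv ℓ f v x₀ / (Nat.factorial ℓ : ℝ) ≤
      ∑ ℓ ∈ Finset.range q, (dirDeriv ℓ f w x₀ + K ℓ * ℓ * R ^ (ℓ - 1) * ‖v - w‖) /
        (Nat.factorial ℓ : ℝ) := by
    refine Finset.sum_le_sum fun ℓ hℓ => ?_
    gcongr
    exact hterm (Finset.mem_range.1 hℓ).le x₀ hx₀
  calc
    _ ≤ _ := add_le_add hsum (div_le_div_of_nonneg_right hsup (Nat.cast_nonneg _))
    _ = _ := by
      rw [Finset.sum_range_succ, add_mul, Finset.sum_mul, upperTaylor]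
      simp only [add_div, Finset.sum_add_distrib, mul_div_right_comm]
      ring

end Bounds

theorem Bup_le_add {d q : ℕ} {f : Euc d → ℝ} {D : Set (Euc d)} {K : ℕ → ℝ} {R : ℝ}
    (hD : D.Nonempty) (hK : ∀ ℓ ≤ q, ∀ z ∈ D, ‖iteratedFDeriv ℝ ℓ f z‖ ≤ K ℓ)
    {x y : Euc d} (hx : ∀ z ∈ D, ‖x - z‖ ≤ R) (hy : ∀ z ∈ D, ‖y - z‖ ≤ R) :
    Bup q f D x ≤ Bup q f D y +
      (∑ ℓ ∈ Finset.range (q + 1), K ℓ * ℓ * R ^ (ℓ - 1) / (Nat.factorial ℓ : ℝ)) * ‖x - y‖ := by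
  rw [Bup_eq_sInf_upperTaylor, Bup_eq_sInf_upperTaylor]
  refine sInf_image_le_sInf_image_add hD ?_ fun z hz => ?_
  · refine ⟨-∑ ℓ ∈ Finset.range (q + 1), K ℓ * R ^ ℓ / (Nat.factorial ℓ : ℝ), ?_⟩
    rintro _ ⟨z, hz, rfl⟩
    exact neg_sum_le_upperTaylor hK hz (hx z hz)
  · simpa using upperTaylor_le_add hK hz (hx z hz) (hy z hz)

/-- Lemma 1 of the paper, uniform/Lipschitz continuity of the upper
extrapolation bound: on a compact `𝒳` there exists `C > 0` such that points of `𝒳` at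
distance less than `ε` have `B^up` values within `C·ε`; in particular `B^up_{q,f,D}` is
Lipschitz continuous on `𝒳`. -/
theorem upper_extrapolation_bound_uniformly_continuous
    {q d : ℕ} (hq : 1 ≤ q) (hd : 1 ≤ d)
    (𝒳 : Set (Euc d)) (h𝒳 : IsCompact 𝒳)
    (f : Euc d → ℝ) (hf : ContDiff ℝ q f)
    (D : Set (Euc d)) (hDsub : D ⊆ 𝒳) (hDne : D.Nonempty) (hDcl : IsClosed D) :
    ∃ C : ℝ, 0 < C ∧
      (∀ ε > (0 : ℝ), ∀ x ∈ 𝒳, ∀ y ∈ 𝒳, ‖x - y‖ < ε →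
        |Bup q f D x - Bup q f D y| ≤ C * ε) ∧
      LipschitzOnWith C.toNNReal (Bup q f D) 𝒳 := by
  have hDcpt : IsCompact D := h𝒳.of_isClosed_subset hDcl hDsub
  have hbound (ℓ : ℕ) : ∃ K : ℝ, ℓ ≤ q → ∀ z ∈ D, ‖iteratedFDeriv ℝ ℓ f z‖ ≤ K := by
    by_cases hℓ : ℓ ≤ q
    · obtain ⟨K, hK⟩ := hDcpt.exists_bound_of_continuousOn
        (hf.continuous_iteratedFDeriv (m := ℓ) (by exact_mod_cast hℓ)).continuousOn
      exact ⟨K, fun _ => hK⟩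
    · exact ⟨0, fun h => absurd h hℓ⟩
  choose K hK using hbound
  have hdist {x : Euc d} (hx : x ∈ 𝒳) (z : Euc d) (hz : z ∈ D) : ‖x - z‖ ≤ Metric.diam 𝒳 := by
    rw [← dist_eq_norm]
    exact Metric.dist_le_diam_of_mem h𝒳.isBounded hx (hDsub hz)
  set L := ∑ ℓ ∈ Finset.range (q + 1),
    K ℓ * ℓ * Metric.diam 𝒳 ^ (ℓ - 1) / (Nat.factorial ℓ : ℝ)
  have hle {x y : Euc d} (hx : x ∈ 𝒳) (hy : y ∈ 𝒳) :
      Bup q f D x ≤ Bup q f D y + (|L| + 1) * ‖x - y‖ := by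
    refine (Bup_le_add hDne hK (hdist hx) (hdist hy)).trans ?_
    gcongr
    linarith [le_abs_self L]
  have hLip {x y : Euc d} (hx : x ∈ 𝒳) (hy : y ∈ 𝒳) :
      |Bup q f D x - Bup q f D y| ≤ (|L| + 1) * ‖x - y‖ := by
    have hyx := hle hy hx
    rw [norm_sub_rev] at hyx
    exact abs_sub_le_iff.2 ⟨by linarith [hle hx hy], by linarith⟩
  have hC : 0 < |L| + 1 := by positivity
  refine ⟨|L| + 1, hC, fun ε _ x hx y hy hxy => (hLip hx hy).trans ?_, ?_⟩
  · gcongr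
  · refine LipschitzOnWith.of_dist_le_mul fun x hx y hy => ?_
    rw [Real.coe_toNNReal _ hC.le, Real.dist_eq, dist_eq_norm]
    exact hLip hx hy
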